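/- Let I ⊆ ℝ be an open interval and m, n ≥ 1 integers. Let P be the differential operator Pf = Σ_{i=0}^{m} α_i·f^{(i)} and Q the differential operator Qf = Σ_{j=0}^{n} β_j·f^{(j)}, with all coefficients α_0,…,α_m, β_0,…,β_n smooth on I. Then there exist functions γ_0,…,γ_{m+n−2} smooth on I such that for every f smooth on I and every t ∈ I: Q(Pf)(t) − P(Qf)(t) = (n·β_n(t)·α_m'(t) − m·α_m(t)·β_n'(t))·f^{(m+n−1)}(t) + Σ_{k=0}^{m+n−2} γ_k(t)·f^{(k)}(t). In particular, the commutator QP − PQ is a differential operator whose coefficient of f^{(m+n−1)} equals n·β_n·α_m' − m·α_m·β_n'. -/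

import Mathlib

open scoped BigOperators

/-- `D` agrees on the functions smooth on `I` with a differential operator of order less than `N`
whose coefficients are smooth on `I`. -/
def IsDiffOpOfOrderLT (I : Set ℝ) (N : ℕ) (D : (ℝ → ℝ) → ℝ → ℝ) : Prop :=
  ∃ γ : ℕ → ℝ → ℝ, (∀ k, ∀ t ∈ I, ContDiffAt ℝ (⊤ : ℕ∞) (γ k) t) ∧
    ∀ f : ℝ → ℝ, (∀ t ∈ I, ContDiffAt ℝ (⊤ : ℕ∞) f t) → ∀ t ∈ I,
      D f t = ∑ k ∈ Finset.range N, γ k t * iteratedDeriv k f t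

theorem ContDiffAt.iteratedDeriv_top {f : ℝ → ℝ} {t : ℝ} (hf : ContDiffAt ℝ (⊤ : ℕ∞) f t) (k : ℕ) :
    ContDiffAt ℝ (⊤ : ℕ∞) (iteratedDeriv k f) t := by
  induction k with
  | zero => simpa using hf
  | succ k ih =>
    rw [iteratedDeriv_succ]
    exact ih.derivWithin (by simp)

theorem iteratedDeriv_iteratedDeriv (i j : ℕ) (f : ℝ → ℝ) :
    iteratedDeriv j (iteratedDeriv i f) = iteratedDeriv (i + j) f := by
  simp only [iteratedDeriv_eq_iterate, add_comm i j, Function.iterate_add_apply]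

theorem iteratedDeriv_sum_mul_iteratedDeriv {a : ℕ → ℝ → ℝ} {f : ℝ → ℝ} {t : ℝ} {N : ℕ}
    (ha : ∀ i < N, ContDiffAt ℝ (⊤ : ℕ∞) (a i) t) (hf : ContDiffAt ℝ (⊤ : ℕ∞) f t) (j : ℕ) :
    iteratedDeriv j (fun s => ∑ i ∈ Finset.range N, a i s * iteratedDeriv i f s) t =
      ∑ i ∈ Finset.range N, iteratedDeriv j (fun s => a i s * iteratedDeriv i f s) t := by
  refine iteratedDeriv_fun_sum fun i hi => ?_
  exact ((ha i (Finset.mem_range.mp hi)).mul (hf.iteratedDeriv_top i)).of_le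
    (by exact_mod_cast le_top)

namespace IsDiffOpOfOrderLT

variable {I : Set ℝ} {N : ℕ} {D E : (ℝ → ℝ) → ℝ → ℝ}

theorem congr (hD : IsDiffOpOfOrderLT I N D)
    (h : ∀ f : ℝ → ℝ, (∀ t ∈ I, ContDiffAt ℝ (⊤ : ℕ∞) f t) → ∀ t ∈ I, E f t = D f t) :
    IsDiffOpOfOrderLT I N E := by
  obtain ⟨γ, hγ, hγD⟩ := hD
  exact ⟨γ, hγ, fun f hf t ht => (h f hf t ht).trans (hγD f hf t ht)⟩

theorem zero : IsDiffOpOfOrderLT I N (fun _ _ => 0) :=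
  ⟨fun _ _ => 0, fun _ _ _ => contDiffAt_const, by simp⟩

theorem add (hD : IsDiffOpOfOrderLT I N D) (hE : IsDiffOpOfOrderLT I N E) :
    IsDiffOpOfOrderLT I N (fun f t => D f t + E f t) := by
  obtain ⟨γ, hγ, hγD⟩ := hD
  obtain ⟨δ, hδ, hδE⟩ := hE
  refine ⟨fun k t => γ k t + δ k t, fun k t ht => (hγ k t ht).add (hδ k t ht),
    fun f hf t ht => ?_⟩
  simp only [hγD f hf t ht, hδE f hf t ht, add_mul, Finset.sum_add_distrib]

theorem sub (hD : IsDiffOpOfOrderLT I N D) (hE : IsDiffOpOfOrderLT I N E) :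
    IsDiffOpOfOrderLT I N (fun f t => D f t - E f t) := by
  obtain ⟨γ, hγ, hγD⟩ := hD
  obtain ⟨δ, hδ, hδE⟩ := hE
  refine ⟨fun k t => γ k t - δ k t, fun k t ht => (hγ k t ht).sub (hδ k t ht),
    fun f hf t ht => ?_⟩
  simp only [hγD f hf t ht, hδE f hf t ht, sub_mul, Finset.sum_sub_distrib]

theorem sum {ι : Type*} (s : Finset ι) {F : ι → (ℝ → ℝ) → ℝ → ℝ}
    (h : ∀ i ∈ s, IsDiffOpOfOrderLT I N (F i)) :
    IsDiffOpOfOrderLT I N (fun f t => ∑ i ∈ s, F i f t) := by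
  classical
  induction s using Finset.induction_on with
  | empty => simpa using zero
  | insert i s hi ih =>
    simp only [Finset.sum_insert hi]
    exact (h i (Finset.mem_insert_self i s)).add
      (ih fun j hj => h j (Finset.mem_insert_of_mem hj))

theorem mul_iteratedDeriv {a : ℝ → ℝ} (ha : ∀ t ∈ I, ContDiffAt ℝ (⊤ : ℕ∞) a t) {k : ℕ}
    (hk : k < N) : IsDiffOpOfOrderLT I N (fun f t => a t * iteratedDeriv k f t) := by
  refine ⟨fun l t => if l = k then a t else 0, fun l t ht => ?_, fun f _ t _ => ?_⟩
  · by_cases h : l = k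
    · simpa [h] using ha t ht
    · simpa [h] using contDiffAt_const
  · simp [hk]

theorem mono {M : ℕ} (hD : IsDiffOpOfOrderLT I N D) (h : N ≤ M) : IsDiffOpOfOrderLT I M D := by
  obtain ⟨γ, hγ, hγD⟩ := hD
  exact (sum (Finset.range N) fun k hk =>
    mul_iteratedDeriv (hγ k) ((Finset.mem_range.mp hk).trans_le h)).congr hγD

/-- The two leading terms of the composition of `f ↦ b * f^(j)` with `f ↦ a * f^(i)`. -/
theorem comp_monomial {a b : ℝ → ℝ} (ha : ∀ t ∈ I, ContDiffAt ℝ (⊤ : ℕ∞) a t)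
    (hb : ∀ t ∈ I, ContDiffAt ℝ (⊤ : ℕ∞) b t) (i j : ℕ) :
    IsDiffOpOfOrderLT I (i + j - 1) (fun f t =>
      b t * iteratedDeriv j (fun s => a s * iteratedDeriv i f s) t
        - a t * b t * iteratedDeriv (i + j) f t
        - j * b t * deriv a t * iteratedDeriv (i + j - 1) f t) := by
  cases j with
  | zero =>
    refine zero.congr fun f hf t ht => ?_
    simp only [iteratedDeriv_zero]
    push_cast
    ring_nf
  | succ j =>
    refine (sum (Finset.range j) (F := fun l f t =>
      (b t * ((j + 1).choose (l + 2) * iteratedDeriv (l + 2) a t))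
        * iteratedDeriv (i + (j + 1 - (l + 2))) f t) fun l hl => ?_).congr fun f hf t ht => ?_
    · refine mul_iteratedDeriv (fun t ht => ?_) ?_
      · exact (hb t ht).mul (contDiffAt_const.mul ((ha t ht).iteratedDeriv_top _))
      · have := Finset.mem_range.mp hl
        omega
    · have hle : ((j + 1 : ℕ) : WithTop ℕ∞) ≤ ((⊤ : ℕ∞) : WithTop ℕ∞) := by
        exact_mod_cast le_top
      have key := iteratedDeriv_mul ((ha t ht).of_le hle)
        (((hf t ht).iteratedDeriv_top i).of_le hle)
      change iteratedDeriv (j + 1) (fun s => a s * iteratedDeriv i f s) t = _ at key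
      simp only [iteratedDeriv_iteratedDeriv] at key
      rw [key, Finset.sum_range_succ', Finset.sum_range_succ']
      have h2 : ∀ l, l + 1 + 1 = l + 2 := fun _ => rfl
      simp only [h2, zero_add, Nat.choose_zero_right, Nat.choose_one_right, iteratedDeriv_zero,
        iteratedDeriv_one, Nat.sub_zero, Nat.add_sub_cancel, ← add_assoc]
      simp only [mul_add, Finset.mul_sum, mul_assoc]
      push_cast
      ring

theorem commutator_monomial {a b : ℝ → ℝ} (ha : ∀ t ∈ I, ContDiffAt ℝ (⊤ : ℕ∞) a t)
    (hb : ∀ t ∈ I, ContDiffAt ℝ (⊤ : ℕ∞) b t) (i j : ℕ) :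
    IsDiffOpOfOrderLT I (i + j - 1) (fun f t =>
      b t * iteratedDeriv j (fun s => a s * iteratedDeriv i f s) t
        - a t * iteratedDeriv i (fun s => b s * iteratedDeriv j f s) t
        - (j * b t * deriv a t - i * a t * deriv b t) * iteratedDeriv (i + j - 1) f t) := by
  have h := comp_monomial hb ha j i
  rw [add_comm j i] at h
  exact ((comp_monomial ha hb i j).sub h).congr fun f hf t ht => by ring

end IsDiffOpOfOrderLT

/-- The commutator `QP - PQ` of the differential operators
`P f = ∑_{i≤m} α_i f^(i)` and `Q f = ∑_{j≤n} β_j f^(j)` with smooth coefficients on the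
open interval `I` is a differential operator of order at most `m+n-1` whose coefficient of
`f^(m+n-1)` equals `n·β_n·α_m' - m·α_m·β_n'`. -/
theorem statement4
    (a₀ b₀ : ℝ) (I : Set ℝ) (hI : I = Set.Ioo a₀ b₀)
    (m n : ℕ) (hm : 1 ≤ m) (hn : 1 ≤ n)
    (α β : ℕ → ℝ → ℝ)
    (hα : ∀ i, i ≤ m → ∀ t ∈ I, ContDiffAt ℝ (⊤ : ℕ∞) (α i) t)
    (hβ : ∀ j, j ≤ n → ∀ t ∈ I, ContDiffAt ℝ (⊤ : ℕ∞) (β j) t)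
    (P Q : (ℝ → ℝ) → ℝ → ℝ)
    (hP : ∀ f t, P f t = ∑ i ∈ Finset.range (m + 1), α i t * iteratedDeriv i f t)
    (hQ : ∀ f t, Q f t = ∑ j ∈ Finset.range (n + 1), β j t * iteratedDeriv j f t) :
    ∃ γ : ℕ → ℝ → ℝ, (∀ k, k ≤ m + n - 2 → ∀ t ∈ I, ContDiffAt ℝ (⊤ : ℕ∞) (γ k) t) ∧
      ∀ f : ℝ → ℝ, (∀ t ∈ I, ContDiffAt ℝ (⊤ : ℕ∞) f t) → ∀ t ∈ I,
        Q (P f) t - P (Q f) t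
          = ((n : ℝ) * β n t * deriv (α m) t - (m : ℝ) * α m t * deriv (β n) t)
              * iteratedDeriv (m + n - 1) f t
            + ∑ k ∈ Finset.range (m + n - 1), γ k t * iteratedDeriv k f t := by
  have hdiff (i : ℕ) (hi : i ≤ m) (j : ℕ) (hj : j ≤ n) :=
    IsDiffOpOfOrderLT.commutator_monomial (hα i hi) (hβ j hj) i j
  have hsum : IsDiffOpOfOrderLT I (m + n - 1) (fun f t =>
      ∑ j ∈ Finset.range (n + 1), ∑ i ∈ Finset.range (m + 1),
        (β j t * iteratedDeriv j (fun s => α i s * iteratedDeriv i f s) t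
          - α i t * iteratedDeriv i (fun s => β j s * iteratedDeriv j f s) t
          - if j = n then if i = m then
              (n * β n t * deriv (α m) t - m * α m t * deriv (β n) t)
                * iteratedDeriv (m + n - 1) f t else 0 else 0)) := by
    refine .sum _ fun j hj => .sum _ fun i hi => ?_
    have hj := Finset.mem_range_succ_iff.mp hj
    have hi := Finset.mem_range_succ_iff.mp hi
    by_cases h : j = n ∧ i = m
    · obtain ⟨rfl, rfl⟩ := h
      simpa using hdiff i hi j hj
    · have hlt : i + j - 1 < m + n - 1 := by omega
      have hcoeff : ∀ t ∈ I, ContDiffAt ℝ (⊤ : ℕ∞)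
          (fun t => j * β j t * deriv (α i) t - i * α i t * deriv (β j) t) t := fun t ht =>
        ((contDiffAt_const.mul (hβ j hj t ht)).mul ((hα i hi t ht).derivWithin (by simp))).sub
          ((contDiffAt_const.mul (hα i hi t ht)).mul ((hβ j hj t ht).derivWithin (by simp)))
      refine (((hdiff i hi j hj).mono hlt.le).add
        (IsDiffOpOfOrderLT.mul_iteratedDeriv hcoeff hlt)).congr fun f hf t ht => ?_
      rw [← ite_and, if_neg h]
      ring
  obtain ⟨γ, hγ, hγD⟩ := hsum
  refine ⟨γ, fun k _ => hγ k, fun f hf t ht => ?_⟩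
  rw [← hγD f hf t ht, hQ, hP, funext (hP f), funext (hQ f)]
  have hPf (j : ℕ) := iteratedDeriv_sum_mul_iteratedDeriv
    (fun i hi => hα i (Nat.lt_succ_iff.mp hi) t ht) (hf t ht) j
  have hQf (i : ℕ) := iteratedDeriv_sum_mul_iteratedDeriv
    (fun j hj => hβ j (Nat.lt_succ_iff.mp hj) t ht) (hf t ht) i
  simp only [hPf, hQf, Finset.mul_sum, Finset.sum_sub_distrib]
  rw [Finset.sum_comm (s := Finset.range (m + 1))]
  simp
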